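/- For all positive integers m and k, there exists a deterministic online algorithm for cardinality constrained scheduling on m machines with cardinality bound k that is 120-competitive: on every input sequence with at most m·k jobs, the induced schedule is feasible and its makespan is at most 120·OPT. -/

import Mathlib

open Finset

/-- The load of machine `i` under schedule `σ` for job sizes `p`. -/
noncomputable def machineLoad {n m : ℕ} (p : Fin n → ℝ) (σ : Fin n → Fin m) (i : Fin m) : ℝ :=
  ∑ j ∈ Finset.univ.filter (fun j => σ j = i), p j

/-- The makespan of a schedule: the maximum machine load. -/
noncomputable def makespan {n m : ℕ} (p : Fin n → ℝ) (σ : Fin n → Fin m) : ℝ :=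
  sSup (Set.range (machineLoad p σ))

/-- A schedule is feasible for cardinality bound `k` if every machine gets at most `k` jobs. -/
def Feasible {n m : ℕ} (k : ℕ) (σ : Fin n → Fin m) : Prop :=
  ∀ i : Fin m, (Finset.univ.filter (fun j => σ j = i)).card ≤ k

/-- The optimal (minimum) makespan over all feasible schedules on `m` machines with
cardinality bound `k`. -/
noncomputable def OPT (m k : ℕ) {n : ℕ} (p : Fin n → ℝ) : ℝ :=
  sInf ((fun σ : Fin n → Fin m => makespan p σ) '' {σ | Feasible k σ})

/-- The schedule induced by a deterministic online algorithm `A` on input sequence `p`: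
job `j` is assigned to the machine `A (p 1, …, p j)`. -/
def onlineSchedule {m : ℕ} (A : List ℝ → Fin m) {n : ℕ} (p : Fin n → ℝ) : Fin n → Fin m :=
  fun j => A ((List.ofFn p).take (j.1 + 1))

/-- An online algorithm is `α`-competitive if on every input sequence of at most `m*k`
nonnegative jobs the induced schedule is feasible and its makespan is at most `α * OPT`. -/
def Competitive (m k : ℕ) (A : List ℝ → Fin m) (α : ℝ) : Prop :=
  ∀ n : ℕ, n ≤ m * k → ∀ p : Fin n → ℝ, (∀ j, 0 ≤ p j) →
    Feasible k (onlineSchedule A p) ∧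
      makespan p (onlineSchedule A p) ≤ α * OPT m k p


/-- A machine of `s` maximizing `f` (an arbitrary machine if `s` is empty). -/
noncomputable def argmaxOn {m : ℕ} [NeZero m] (f : Fin m → ℕ) (s : Finset (Fin m)) : Fin m :=
  if h : s.Nonempty then (s.exists_max_image f h).choose else 0

lemma argmaxOn_mem {m : ℕ} [NeZero m] (f : Fin m → ℕ) {s : Finset (Fin m)} (h : s.Nonempty) :
    argmaxOn f s ∈ s := by
  rw [argmaxOn, dif_pos h]
  exact (s.exists_max_image f h).choose_spec.1

lemma le_argmaxOn {m : ℕ} [NeZero m] (f : Fin m → ℕ) {s : Finset (Fin m)} {i : Fin m}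
    (hi : i ∈ s) : f i ≤ f (argmaxOn f s) := by
  have h : s.Nonempty := ⟨i, hi⟩
  rw [argmaxOn, dif_pos h]
  exact (s.exists_max_image f h).choose_spec.2 i hi

/-- The state of the online algorithm. Jobs are classified by the integer part of the binary
logarithm of their size; `visited c` is the set of machines used in the current block of
class `c`. -/
structure SchedState (m : ℕ) where
  /-- the number of free slots of each machine -/
  free : Fin m → ℕ
  /-- the machines used in the current block of each class -/
  visited : ℤ → Finset (Fin m)
  /-- the largest job size so far -/
  maxSize : ℝ
  /-- the load of each machine -/
  load : Fin m → ℝ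
  /-- the machine that received the latest job -/
  last : Fin m

namespace SchedState

variable {m : ℕ}

/-- The state before the first job. -/
def initial [NeZero m] (k : ℕ) : SchedState m where
  free := fun _ => k
  visited := fun _ => ∅
  maxSize := 0
  load := fun _ => 0
  last := 0

/-- Put a job of size `x` on machine `j` and replace the visited sets by `V`. -/
noncomputable def place (S : SchedState m) (x : ℝ) (j : Fin m) (V : ℤ → Finset (Fin m)) :
    SchedState m where
  free := Function.update S.free j (S.free j - 1)
  visited := V
  maxSize := max S.maxSize x
  load := Function.update S.load j (S.load j + x)
  last := j

/-- The block of machines `V` after machine `j` is added; a block is closed as soon as it has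
`b + 1` elements. -/
def extendBlock (b : ℕ) (V : Finset (Fin m)) (j : Fin m) : Finset (Fin m) :=
  if (insert j V).card ≤ b then insert j V else ∅

/-- A machine with the most free slots. -/
noncomputable def top [NeZero m] (S : SchedState m) : Fin m := argmaxOn S.free univ

/-- A machine with the most free slots among those outside the current block of class `c`. -/
noncomputable def target [NeZero m] (S : SchedState m) (c : ℤ) : Fin m :=
  argmaxOn S.free (S.visited c)ᶜ

/-- One step of the algorithm. Small jobs go to a machine with the most free slots, large jobs to
such a machine outside the current block of their class. -/
noncomputable def step [NeZero m] (b : ℕ) (S : SchedState m) (x : ℝ) : SchedState m :=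
  if x * 2 ^ (S.free S.top - 1) ≤ max S.maxSize x then S.place x S.top S.visited
  else S.place x (S.target (Int.log 2 x)) (Function.update S.visited (Int.log 2 x)
    (extendBlock b (S.visited (Int.log 2 x)) (S.target (Int.log 2 x))))

/-- The number of further jobs that class `c` can receive before machine `i` leaves its block. -/
def remaining (b : ℕ) (V : Finset (Fin m)) (i : Fin m) : ℕ :=
  if i ∈ V then b + 1 - V.card else 0

/-- The number of jobs that were put on machines with at most `h` free slots. -/
def deficit (f : Fin m → ℕ) (h : ℕ) : ℕ := ∑ j, (h - f j)

/-- The classes within a factor `2 ^ (2 * h)` of the largest job. -/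
noncomputable def window (M : ℝ) (h : ℕ) : Finset ℤ :=
  Finset.Icc (Int.log 2 M - 2 * h) (Int.log 2 M)

/-- The bound on the number of jobs put on machines with at most `h` free slots while machine `i`
still has more. -/
def LagBound (b : ℕ) (S : SchedState m) (h : ℕ) (i : Fin m) : Prop :=
  deficit S.free h + ∑ c ∈ window S.maxSize h, remaining b (S.visited c) i + S.free i * b
    ≤ b * (4 * h + 2)

/-- The number of jobs in the block `V`, less `b + 1` if machine `i` received one of them. -/
noncomputable def blockBalance (b : ℕ) (V : Finset (Fin m)) (i : Fin m) : ℝ :=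
  V.card - if i ∈ V then (b + 1 : ℝ) else 0

/-- The invariant of the algorithm. -/
structure Invariant (b : ℕ) (S : SchedState m) : Prop where
  maxSize_nonneg : 0 ≤ S.maxSize
  zpow_le : ∀ c, (S.visited c).Nonempty → (2 : ℝ) ^ c ≤ S.maxSize
  card_le : ∀ c, (S.visited c).card ≤ b
  free_le : ∀ i j, S.free i ≤ 2 * S.free j + 3
  lag : ∀ h i, h < S.free i → (∃ j, S.free j < h) → LagBound b S h i
  load_le : ∃ F : Finset ℤ, (∀ c, c ∉ F → S.visited c = ∅) ∧ ∀ i,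
    (b + 1) * S.load i + ∑ c ∈ F, (2 : ℝ) ^ (c + 1) * blockBalance b (S.visited c) i
      ≤ (b + 1) * (S.maxSize * (2 / 2 ^ S.free i)) + 2 * ∑ j, S.load j

lemma invariant_initial [NeZero m] (b k : ℕ) : Invariant b (initial k : SchedState m) where
  maxSize_nonneg := le_rfl
  zpow_le := by simp [initial]
  card_le := by simp [initial]
  free_le := by simp only [initial]; intros; omega
  lag := by
    rintro h i h1 ⟨j, h2⟩
    simp only [initial] at h1 h2
    omega
  load_le := ⟨∅, by simp [initial], by simp [initial]⟩

lemma remaining_le (b : ℕ) (V : Finset (Fin m)) (i : Fin m) : remaining b V i ≤ b := by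
  unfold remaining
  split_ifs with h
  · have := Finset.card_pos.2 ⟨i, h⟩
    omega
  · omega

lemma remaining_of_notMem (b : ℕ) {V : Finset (Fin m)} {i : Fin m} (h : i ∉ V) :
    remaining b V i = 0 := if_neg h

lemma card_extendBlock_le (b : ℕ) (V : Finset (Fin m)) (j : Fin m) :
    (extendBlock b V j).card ≤ b := by
  unfold extendBlock
  split_ifs with h
  · exact h
  · simp

lemma remaining_extendBlock_of_mem {b : ℕ} {V : Finset (Fin m)} {i j : Fin m} (hV : V.card ≤ b)
    (hj : j ∉ V) (hi : i ∈ V) : remaining b (extendBlock b V j) i + 1 ≤ remaining b V i := by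
  unfold extendBlock
  split_ifs with h
  · rw [Finset.card_insert_of_notMem hj] at h
    simp only [remaining, Finset.mem_insert, hi, or_true, if_true,
      Finset.card_insert_of_notMem hj]
    omega
  · simp only [remaining, hi, if_true, Finset.notMem_empty, if_false]
    omega

lemma remaining_extendBlock_of_ne {b : ℕ} {V : Finset (Fin m)} {i j : Fin m} (hV : V.card ≤ b)
    (hj : j ∉ V) (hij : i ≠ j) : remaining b (extendBlock b V j) i ≤ remaining b V i := by
  by_cases hi : i ∈ V
  · have := remaining_extendBlock_of_mem hV hj hi
    omega
  · rw [remaining_of_notMem b (V := extendBlock b V j)]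
    · exact Nat.zero_le _
    · unfold extendBlock
      split_ifs <;> simp [hi, hij]

lemma blockBalance_extendBlock_le {b : ℕ} {V : Finset (Fin m)} {j : Fin m} (hV : V.card ≤ b)
    (hj : j ∉ V) (i : Fin m) :
    blockBalance b (extendBlock b V j) i
      ≤ blockBalance b V i + 1 - if i = j then (b + 1 : ℝ) else 0 := by
  have hb : (0 : ℝ) ≤ b := Nat.cast_nonneg b
  unfold extendBlock blockBalance
  rw [Finset.card_insert_of_notMem hj]
  by_cases h : V.card + 1 ≤ b
  · simp only [if_pos h, Finset.card_insert_of_notMem hj, Finset.mem_insert]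
    push_cast
    by_cases hij : i = j
    · simp [hij, hj]
    · simp only [hij, false_or, if_false]
      linarith
  · have hVb : (V.card : ℝ) = b := by
      have : V.card = b := by omega
      exact_mod_cast this
    simp only [if_neg h, Finset.card_empty, Finset.notMem_empty, if_false, hVb]
    by_cases hij : i = j
    · simp [hij, hj]
    · rw [if_neg hij]
      split_ifs <;> push_cast <;> linarith

lemma sum_window_anti {b : ℕ} {S : SchedState m} (hS : Invariant b S) {M : ℝ}
    (hM : S.maxSize ≤ M) (h : ℕ) (i : Fin m) :
    ∑ c ∈ window M h, remaining b (S.visited c) i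
      ≤ ∑ c ∈ window S.maxSize h, remaining b (S.visited c) i := by
  refine Finset.sum_le_sum_of_ne_zero fun c hc hne => ?_
  have hi : i ∈ S.visited c := by
    by_contra hi
    exact hne (remaining_of_notMem b hi)
  have h2 := hS.zpow_le c ⟨i, hi⟩
  have hpos : 0 < S.maxSize := lt_of_lt_of_le (by positivity) h2
  have h3 : c ≤ Int.log 2 S.maxSize :=
    (Int.zpow_le_iff_le_log (by norm_num) hpos).1 (by exact_mod_cast h2)
  have h4 := Int.log_mono_right (b := 2) hpos hM
  simp only [window, Finset.mem_Icc] at hc ⊢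
  omega

lemma sum_window_le (b : ℕ) (S : SchedState m) (h : ℕ) (i : Fin m) :
    ∑ c ∈ window S.maxSize h, remaining b (S.visited c) i ≤ (2 * h + 1) * b := by
  have := Finset.sum_le_card_nsmul (window S.maxSize h)
    (fun c => remaining b (S.visited c) i) b fun c _ => remaining_le _ _ _
  have hcard : (window S.maxSize h).card = 2 * h + 1 := by
    simp only [window, Int.card_Icc]
    omega
  rwa [hcard, smul_eq_mul] at this

/-- A machine that is passed over by a large job has at most `2 * a + 1` free slots if the job is
placed on a machine with `a` free slots. -/
lemma free_le_target [NeZero m] {b : ℕ} (hb : 7 * b < m) {S : SchedState m}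
    (hS : Invariant b S) (c : ℤ) (i : Fin m) : S.free i ≤ 2 * S.free (S.target c) + 1 := by
  by_contra! hi
  set a := S.free (S.target c) with ha
  have hlag := hS.lag (2 * a + 1) i (by omega) ⟨S.target c, by omega⟩
  have hdef : (m - (S.visited c).card) * (a + 1) ≤ deficit S.free (2 * a + 1) := by
    have h1 : ((S.visited c)ᶜ).card • (a + 1) ≤ ∑ j ∈ (S.visited c)ᶜ, (2 * a + 1 - S.free j) := by
      refine Finset.card_nsmul_le_sum _ _ _ fun j hj => ?_
      have : S.free j ≤ a := le_argmaxOn S.free hj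
      omega
    rw [Finset.card_compl, Fintype.card_fin, smul_eq_mul] at h1
    exact h1.trans (Finset.sum_le_sum_of_subset (Finset.subset_univ _))
  have hcard := hS.card_le c
  have h2 : (6 * b + 1) * (a + 1) ≤ (m - (S.visited c).card) * (a + 1) :=
    Nat.mul_le_mul_right _ (by omega)
  have h3 : (2 * a + 2) * b ≤ S.free i * b := Nat.mul_le_mul_right _ (by omega)
  have h4 : deficit S.free (2 * a + 1) + S.free i * b ≤ b * (4 * (2 * a + 1) + 2) := by
    unfold LagBound at hlag
    omega
  nlinarith

lemma target_notMem [NeZero m] {b : ℕ} (hb : 7 * b < m) {S : SchedState m}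
    (hS : Invariant b S) (c : ℤ) : S.target c ∉ S.visited c := by
  have hne : ((S.visited c)ᶜ).Nonempty := by
    rw [← Finset.card_pos, Finset.card_compl, Fintype.card_fin]
    have := hS.card_le c
    omega
  exact Finset.mem_compl.1 (argmaxOn_mem S.free hne)

lemma free_le_top [NeZero m] (S : SchedState m) (i : Fin m) : S.free i ≤ S.free S.top :=
  le_argmaxOn S.free (Finset.mem_univ i)

lemma mem_visited_of_target_lt [NeZero m] {S : SchedState m} {c : ℤ} {i : Fin m}
    (h : S.free (S.target c) < S.free i) : i ∈ S.visited c := by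
  by_contra hi
  exact absurd (le_argmaxOn S.free (Finset.mem_compl.2 hi)) (not_le.2 h)

lemma free_place (S : SchedState m) (x : ℝ) (j i : Fin m) (V : ℤ → Finset (Fin m)) :
    (S.place x j V).free i = if i = j then S.free j - 1 else S.free i := by
  simp [place, Function.update_apply]

lemma free_place_le (S : SchedState m) (x : ℝ) (j i : Fin m) (V : ℤ → Finset (Fin m)) :
    (S.place x j V).free i ≤ S.free i := by
  rw [free_place]
  split_ifs with h
  · subst h; omega
  · exact le_rfl

lemma sum_load_place (S : SchedState m) (x : ℝ) (j : Fin m) (V : ℤ → Finset (Fin m)) :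
    ∑ i, (S.place x j V).load i = ∑ i, S.load i + x := by
  simp only [place]
  rw [Finset.sum_update_of_mem (Finset.mem_univ j), ← Finset.erase_eq,
    ← Finset.add_sum_erase univ S.load (Finset.mem_univ j)]
  ring

lemma deficit_place_of_lt {S : SchedState m} {x : ℝ} {j : Fin m} {V : ℤ → Finset (Fin m)}
    {h : ℕ} (hj : h < S.free j) : deficit (S.place x j V).free h = deficit S.free h := by
  refine Finset.sum_congr rfl fun i _ => ?_
  rw [free_place]
  split_ifs with hi
  · subst hi; omega
  · rfl

lemma deficit_place_le (S : SchedState m) (x : ℝ) (j : Fin m) (V : ℤ → Finset (Fin m))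
    (h : ℕ) : deficit (S.place x j V).free h ≤ deficit S.free h + 1 := by
  have : deficit S.free h + 1 = ∑ i, (h - S.free i + if i = j then 1 else 0) := by
    simp [deficit, Finset.sum_add_distrib]
  rw [this]
  refine Finset.sum_le_sum fun i _ => ?_
  rw [free_place]
  split_ifs with hi
  · subst hi; omega
  · omega

lemma lagBound_of_le {b : ℕ} {S : SchedState m} {h : ℕ} (i : Fin m)
    (h1 : ∀ j, h ≤ S.free j) (h2 : S.free i ≤ 2 * h + 1) : LagBound b S h i := by
  have hd : deficit S.free h = 0 := by
    simp only [deficit, Finset.sum_eq_zero_iff]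
    intro j _
    have := h1 j
    omega
  have := sum_window_le b S h i
  have h3 : S.free i * b ≤ (2 * h + 1) * b := Nat.mul_le_mul_right _ h2
  unfold LagBound
  nlinarith

/-- The lag bound holds before a job is placed if its hypotheses hold afterwards. -/
lemma lagBound_of_place {b : ℕ} {S : SchedState m} (hS : Invariant b S) {x : ℝ} {t : Fin m}
    {V : ℤ → Finset (Fin m)} (ht : ∀ i, S.free i ≤ 2 * S.free t + 1) {h : ℕ} {i : Fin m}
    (hi : h < (S.place x t V).free i) (hj : ∃ j, (S.place x t V).free j < h) :
    LagBound b S h i ∧ ∀ l, S.free l ≤ 2 * h + 1 := by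
  have hi' : h < S.free i := hi.trans_le (free_place_le ..)
  by_cases hex : ∃ j, S.free j < h
  · refine ⟨hS.lag h i hi' hex, fun l => ?_⟩
    obtain ⟨j, hj⟩ := hex
    have := hS.free_le l j
    omega
  · push Not at hex
    obtain ⟨j, hj⟩ := hj
    have h1 := hex j
    rw [free_place] at hj
    have h2 : S.free t ≤ h := by
      split_ifs at hj with hjt
      · omega
      · omega
    have h3 : ∀ l, S.free l ≤ 2 * h + 1 := fun l => (ht l).trans (by omega)
    exact ⟨lagBound_of_le i hex (h3 i), h3⟩

lemma free_le_place {b : ℕ} {S : SchedState m} (hS : Invariant b S) {x : ℝ} {t : Fin m}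
    {V : ℤ → Finset (Fin m)} (ht : ∀ i, S.free i ≤ 2 * S.free t + 1) (i j : Fin m) :
    (S.place x t V).free i ≤ 2 * (S.place x t V).free j + 3 := by
  have h1 := free_place_le S x t i V
  have h2 := ht i
  have h3 := hS.free_le i j
  rw [free_place S x t j]
  split_ifs <;> omega

lemma invariant_place_top [NeZero m] {b : ℕ} {S : SchedState m} (hS : Invariant b S) {x : ℝ}
    (hx : 0 ≤ x) (hpos : 0 < S.free S.top)
    (hsmall : x * 2 ^ (S.free S.top - 1) ≤ max S.maxSize x) :
    Invariant b (S.place x S.top S.visited) := by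
  have ht : ∀ i, S.free i ≤ 2 * S.free S.top + 1 := fun i => (S.free_le_top i).trans (by omega)
  refine ⟨hS.maxSize_nonneg.trans (le_max_left _ _),
    fun c hc => (hS.zpow_le c hc).trans (le_max_left _ _), hS.card_le, free_le_place hS ht, ?_, ?_⟩
  · intro h i hi hj
    obtain ⟨h1, -⟩ := lagBound_of_place hS ht hi hj
    have hle := free_place_le S x S.top i S.visited
    have h2 := sum_window_anti hS (le_max_left S.maxSize x) h i
    have h3 : h < S.free S.top := hi.trans_le (hle.trans (S.free_le_top i))
    unfold LagBound at h1 ⊢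
    rw [deficit_place_of_lt h3]
    have h4 := Nat.mul_le_mul_right b hle
    simp only [place] at h4 ⊢
    omega
  · obtain ⟨F, hF, hload⟩ := hS.load_le
    refine ⟨F, hF, fun i => ?_⟩
    have hb : (0 : ℝ) ≤ b + 1 := by positivity
    rw [sum_load_place, free_place]
    have h1 := hload i
    have hM : S.maxSize ≤ max S.maxSize x := le_max_left _ _
    simp only [place, Function.update_apply]
    set M := max S.maxSize x
    by_cases hi : i = S.top
    · rw [if_pos hi, if_pos hi, ← hi]
      rw [← hi] at hsmall hpos
      obtain ⟨s, hs⟩ : ∃ s, S.free i = s + 1 := ⟨S.free i - 1, by omega⟩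
      rw [hs] at h1 hsmall ⊢
      simp only [Nat.add_sub_cancel] at hsmall ⊢
      have h2 : x ≤ M * (1 / 2 ^ s) := by
        rw [mul_one_div, le_div_iff₀ (by positivity)]
        exact hsmall
      have h3 : S.maxSize * (1 / 2 ^ s) ≤ M * (1 / 2 ^ s) := by gcongr
      have h4 : (2 : ℝ) / 2 ^ (s + 1) = 1 / 2 ^ s := by
        rw [pow_succ]; field_simp
      have h5 : (2 : ℝ) / 2 ^ s = 1 / 2 ^ s + 1 / 2 ^ s := by ring
      rw [h4] at h1
      rw [h5]
      have h6 : (b + 1) * x + (b + 1) * (S.maxSize * (1 / 2 ^ s))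
          ≤ (b + 1) * (M * (1 / 2 ^ s) + M * (1 / 2 ^ s)) := by
        rw [← mul_add]
        gcongr
      linarith
    · rw [if_neg hi, if_neg hi]
      have h3 : (b + 1) * (S.maxSize * (2 / 2 ^ S.free i))
          ≤ (b + 1) * (M * (2 / 2 ^ S.free i)) := by gcongr
      linarith

lemma sum_le_sum_add_of_eq_off {ι : Type*} [DecidableEq ι] {f g : ι → ℕ} {c : ι} {a : ℕ}
    (W : Finset ι) (h : ∀ d, d ≠ c → f d = g d) (hc : f c ≤ g c + a) :
    ∑ d ∈ W, f d ≤ ∑ d ∈ W, g d + a := by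
  by_cases hW : c ∈ W
  · have h1 : ∑ d ∈ W.erase c, f d = ∑ d ∈ W.erase c, g d :=
      Finset.sum_congr rfl fun d hd => h d (Finset.ne_of_mem_erase hd)
    rw [← Finset.add_sum_erase W f hW, ← Finset.add_sum_erase W g hW, h1]
    omega
  · have h1 : ∑ d ∈ W, f d = ∑ d ∈ W, g d :=
      Finset.sum_congr rfl fun d hd => h d (ne_of_mem_of_not_mem hd hW)
    omega

lemma two_zpow_succ_log_le {x : ℝ} (hx : 0 < x) : (2 : ℝ) ^ (Int.log 2 x + 1) ≤ 2 * x := by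
  have := Int.zpow_log_le_self (b := 2) (by norm_num) hx
  rw [zpow_add₀ two_ne_zero, zpow_one]
  push_cast at this
  linarith

lemma le_two_zpow_succ_log (x : ℝ) : x ≤ (2 : ℝ) ^ (Int.log 2 x + 1) := by
  exact_mod_cast (Int.lt_zpow_succ_log_self (b := 2) (by norm_num) x).le

/-- A job that is large with respect to `s` free slots belongs to the window of `s`. -/
lemma log_mem_window {M x : ℝ} (hx : 0 < x) (hxM : x ≤ M) {s h : ℕ} (hs : s ≤ 2 * h)
    (hlarge : M < x * 2 ^ s) : Int.log 2 x ∈ window M h := by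
  have hM : 0 < M := hx.trans_le hxM
  have h1 : Int.log 2 x ≤ Int.log 2 M := Int.log_mono_right hx hxM
  have h2 : (2 : ℝ) ^ Int.log 2 M < 2 ^ (Int.log 2 x + 1 + s) := by
    have h3 : (2 : ℝ) ^ Int.log 2 M ≤ M := by
      exact_mod_cast Int.zpow_log_le_self (b := 2) (by norm_num) hM
    rw [zpow_add₀ two_ne_zero, zpow_natCast]
    refine (h3.trans_lt hlarge).trans_le ?_
    gcongr
    exact le_two_zpow_succ_log x
  have h3 := (zpow_lt_zpow_iff_right₀ (by norm_num : (1 : ℝ) < 2)).1 h2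
  simp only [window, Finset.mem_Icc]
  omega

lemma lagBound_place_target [NeZero m] {b : ℕ} (hb : 7 * b < m) {S : SchedState m}
    (hS : Invariant b S) {x : ℝ} (hx : 0 < x)
    (hlarge : max S.maxSize x < x * 2 ^ (S.free S.top - 1)) {V : ℤ → Finset (Fin m)}
    (hV : V = Function.update S.visited (Int.log 2 x)
      (extendBlock b (S.visited (Int.log 2 x)) (S.target (Int.log 2 x)))) {h : ℕ} {i : Fin m}
    (hi : h < (S.place x (S.target (Int.log 2 x)) V).free i)
    (hj : ∃ j, (S.place x (S.target (Int.log 2 x)) V).free j < h) :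
    LagBound b (S.place x (S.target (Int.log 2 x)) V) h i := by
  set c := Int.log 2 x with hc
  set t := S.target c with htdef
  obtain ⟨h1, htop⟩ := lagBound_of_place hS (free_le_target hb hS c) hi hj
  have hnot : t ∉ S.visited c := target_notMem hb hS c
  have hcard := hS.card_le c
  have h2 := sum_window_anti hS (le_max_left S.maxSize x) h i
  have hoff : ∀ d, d ≠ c → remaining b (V d) i = remaining b (S.visited d) i := by
    intro d hd
    rw [hV, Function.update_of_ne hd]
  have hVc : V c = extendBlock b (S.visited c) t := by rw [hV, Function.update_self]
  have hle := free_place_le S x t i V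
  unfold LagBound at h1 ⊢
  change deficit (S.place x t V).free h
    + ∑ d ∈ window (max S.maxSize x) h, remaining b (V d) i + (S.place x t V).free i * b ≤ _
  by_cases hth : h < S.free t
  · rw [deficit_place_of_lt hth]
    by_cases hit : i = t
    · have h3 := sum_le_sum_add_of_eq_off (a := b) (window (max S.maxSize x) h) hoff
        ((remaining_le b (V c) i).trans (Nat.le_add_left ..))
      have h4 : (S.place x t V).free i * b + b = S.free i * b := by
        rw [free_place, if_pos hit, ← hit, ← Nat.succ_mul]
        congr 1
        rw [hit]
        omega
      omega
    · have h3 := sum_le_sum_add_of_eq_off (a := 0) (window (max S.maxSize x) h) hoff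
        (by rw [hVc]; exact remaining_extendBlock_of_ne hcard hnot hit)
      have h4 := Nat.mul_le_mul_right b hle
      omega
  · have hmem : i ∈ S.visited c := mem_visited_of_target_lt (by rw [← htdef]; omega)
    have hw : c ∈ window (max S.maxSize x) h :=
      log_mem_window hx (le_max_right _ _) (by have := htop S.top; omega) hlarge
    have h3 : ∑ d ∈ window (max S.maxSize x) h, remaining b (V d) i
        < ∑ d ∈ window (max S.maxSize x) h, remaining b (S.visited d) i := by
      have h5 : remaining b (V c) i + 1 ≤ remaining b (S.visited c) i := by
        rw [hVc]
        exact remaining_extendBlock_of_mem hcard hnot hmem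
      refine Finset.sum_lt_sum (fun d _ => ?_) ⟨c, hw, h5⟩
      by_cases hd : d = c
      · rw [hd]; omega
      · exact (hoff d hd).le
    have h4 := Nat.mul_le_mul_right b hle
    have h5 := deficit_place_le S x t V h
    omega

lemma invariant_place_target [NeZero m] {b : ℕ} (hb : 7 * b < m) {S : SchedState m}
    (hS : Invariant b S) {x : ℝ} (hx : 0 < x)
    (hlarge : max S.maxSize x < x * 2 ^ (S.free S.top - 1)) :
    Invariant b (S.place x (S.target (Int.log 2 x)) (Function.update S.visited (Int.log 2 x)
      (extendBlock b (S.visited (Int.log 2 x)) (S.target (Int.log 2 x))))) := by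
  refine ⟨hS.maxSize_nonneg.trans (le_max_left _ _), ?_, ?_,
    free_le_place hS (free_le_target hb hS _),
    fun h i => lagBound_place_target hb hS hx hlarge rfl, ?_⟩
  · intro d hd
    simp only [place] at hd ⊢
    by_cases hdc : d = Int.log 2 x
    · rw [hdc]
      refine le_trans ?_ (le_max_right _ _)
      exact_mod_cast Int.zpow_log_le_self (b := 2) (by norm_num) hx
    · rw [Function.update_of_ne hdc] at hd
      exact (hS.zpow_le d hd).trans (le_max_left _ _)
  · intro d
    simp only [place, Function.update_apply]
    split_ifs
    · exact card_extendBlock_le ..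
    · exact hS.card_le d
  · obtain ⟨F, hF, hload⟩ := hS.load_le
    set c := Int.log 2 x with hc
    set t := S.target c with ht
    have hnot : t ∉ S.visited c := target_notMem hb hS c
    refine ⟨insert c F, fun d hd => ?_, fun i => ?_⟩
    · rw [Finset.mem_insert, not_or] at hd
      simp only [place]
      rw [Function.update_of_ne hd.1]
      exact hF d hd.2
    · rw [sum_load_place]
      have h1 := hload i
      have hbal := blockBalance_extendBlock_le (hS.card_le c) hnot i
      have hzero : ∑ d ∈ F, (2 : ℝ) ^ (d + 1) * blockBalance b (S.visited d) i
          = ∑ d ∈ insert c F, (2 : ℝ) ^ (d + 1) * blockBalance b (S.visited d) i :=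
        (Finset.sum_insert_of_eq_zero_if_notMem fun hcF => by
          simp [blockBalance, hF c hcF]).symm
      have hmemc := Finset.mem_insert_self c F
      have hM : S.maxSize * (2 / 2 ^ S.free i) ≤ max S.maxSize x *
          (2 / 2 ^ (S.place x t (Function.update S.visited c
            (extendBlock b (S.visited c) t))).free i) := by
        have h0 := hS.maxSize_nonneg
        gcongr
        · exact le_max_left _ _
        · norm_num
        · exact free_place_le ..
      have hM' := mul_le_mul_of_nonneg_left hM (by positivity : (0 : ℝ) ≤ b + 1)
      rw [hzero, ← Finset.add_sum_erase _ _ hmemc] at h1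
      rw [← Finset.add_sum_erase _ _ hmemc]
      simp only [place, Function.update_self] at hM' ⊢
      rw [Finset.sum_congr rfl fun d hd => by
        rw [Function.update_of_ne (Finset.ne_of_mem_erase hd)]]
      have hpow := two_zpow_succ_log_le hx
      have hpow' := le_two_zpow_succ_log x
      rw [← hc] at hpow hpow'
      have hb0 : (0 : ℝ) ≤ b + 1 := by positivity
      have hstep := mul_le_mul_of_nonneg_left hbal
        (by positivity : (0 : ℝ) ≤ 2 ^ (c + 1))
      have hxb := mul_le_mul_of_nonneg_left hpow' hb0
      by_cases hit : i = t
      · rw [if_pos hit] at hstep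
        rw [hit, Function.update_self, ← hit]
        rw [← hit] at hM' hstep
        linarith
      · rw [if_neg hit] at hstep
        rw [Function.update_of_ne hit]
        linarith

lemma step_spec [NeZero m] {b : ℕ} (hb : 7 * b < m) {S : SchedState m} (hS : Invariant b S)
    {x : ℝ} (hx : 0 ≤ x) (hfree : ∃ i, 0 < S.free i) :
    Invariant b (S.step b x) ∧ 0 < S.free (S.step b x).last := by
  obtain ⟨i, hi⟩ := hfree
  have hpos : 0 < S.free S.top := hi.trans_le (S.free_le_top i)
  unfold step
  split_ifs with hsmall
  · exact ⟨invariant_place_top hS hx hpos hsmall, hpos⟩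
  · rw [not_le] at hsmall
    have hx' : 0 < x := by
      by_contra! h0
      have : x = 0 := le_antisymm h0 hx
      subst this
      have := le_max_right S.maxSize 0
      linarith
    refine ⟨invariant_place_target hb hS hx' hsmall, ?_⟩
    have h1 := free_le_target hb hS (Int.log 2 x) S.top
    by_contra! h0
    simp only [place] at h0
    have h2 : S.free S.top - 1 = 0 := by omega
    rw [h2, pow_zero, mul_one] at hsmall
    exact absurd (le_max_right S.maxSize x) (not_le.2 hsmall)

lemma free_step [NeZero m] (b : ℕ) (S : SchedState m) (x : ℝ) (i : Fin m) :
    (S.step b x).free i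
      = if i = (S.step b x).last then S.free i - 1 else S.free i := by
  unfold step
  split_ifs <;> simp_all [place]

lemma load_step [NeZero m] (b : ℕ) (S : SchedState m) (x : ℝ) (i : Fin m) :
    (S.step b x).load i = S.load i + if (S.step b x).last = i then x else 0 := by
  unfold step
  split_ifs <;> simp_all [place]
  all_goals rw [Function.update_of_ne (Ne.symm ‹_›)]

lemma maxSize_step [NeZero m] (b : ℕ) (S : SchedState m) (x : ℝ) :
    (S.step b x).maxSize = max S.maxSize x := by
  unfold step
  split_ifs <;> rfl

end SchedState

open SchedState

lemma sum_two_zpow_le (F : Finset ℤ) :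
    ∀ M : ℤ, (∀ c ∈ F, c ≤ M) → ∑ c ∈ F, (2 : ℝ) ^ c ≤ 2 ^ (M + 1) := by
  induction F using Finset.induction_on_max with
  | empty => intro M _; rw [Finset.sum_empty]; positivity
  | insert a s ha ih =>
    intro M hM
    have h1 := ih (a - 1) fun c hc => by have := ha c hc; omega
    rw [Finset.sum_insert fun h => lt_irrefl _ (ha a h)]
    rw [sub_add_cancel] at h1
    have h2 : (2 : ℝ) ^ (a + 1) ≤ 2 ^ (M + 1) :=
      zpow_le_zpow_right₀ (by norm_num) (by have := hM a (Finset.mem_insert_self _ _); omega)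
    rw [zpow_add₀ two_ne_zero, zpow_one] at h2
    linarith

lemma SchedState.Invariant.load_le_maxSize_add_sum {m b : ℕ} {S : SchedState m}
    (hS : Invariant b S) (i : Fin m) :
    (b + 1) * S.load i ≤ 6 * (b + 1) * S.maxSize + 2 * ∑ j, S.load j := by
  obtain ⟨F, -, hload⟩ := hS.load_le
  have h1 := hload i
  have hM := hS.maxSize_nonneg
  have h2 : -((b + 1) * (4 * S.maxSize))
      ≤ ∑ c ∈ F, (2 : ℝ) ^ (c + 1) * blockBalance b (S.visited c) i := by
    have h3 : ∀ c ∈ F, -((b + 1) * (if (S.visited c).Nonempty then (2 : ℝ) ^ (c + 1) else 0))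
        ≤ (2 : ℝ) ^ (c + 1) * blockBalance b (S.visited c) i := by
      intro c _
      have hpow : (0 : ℝ) < 2 ^ (c + 1) := by positivity
      have hcard : (0 : ℝ) ≤ (S.visited c).card := Nat.cast_nonneg _
      have hb : (0 : ℝ) ≤ b := Nat.cast_nonneg _
      unfold blockBalance
      by_cases hi : i ∈ S.visited c
      · rw [if_pos ⟨i, hi⟩, if_pos hi]
        nlinarith
      · rw [if_neg hi]
        split_ifs <;> nlinarith [mul_nonneg hb hpow.le, mul_nonneg hcard hpow.le]
    refine le_trans ?_ (Finset.sum_le_sum h3)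
    rw [Finset.sum_neg_distrib, ← Finset.mul_sum, neg_le_neg_iff]
    refine mul_le_mul_of_nonneg_left ?_ (by positivity)
    rw [← Finset.sum_filter]
    rcases hM.eq_or_lt with h0 | hpos
    · rw [Finset.filter_false_of_mem, Finset.sum_empty]
      · linarith
      · intro c _ hc
        have := hS.zpow_le c hc
        have : (0 : ℝ) < 2 ^ c := by positivity
        linarith
    · have h4 := sum_two_zpow_le (F.filter fun c => (S.visited c).Nonempty)
        (Int.log 2 S.maxSize) fun c hc => by
          rw [Finset.mem_filter] at hc
          exact (Int.zpow_le_iff_le_log (by norm_num) hpos).1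
            (by exact_mod_cast hS.zpow_le c hc.2)
      have h5 := two_zpow_succ_log_le hpos
      simp_rw [zpow_add₀ (two_ne_zero : (2 : ℝ) ≠ 0) _ 1, zpow_one, ← Finset.sum_mul]
      linarith
  have h6 : S.maxSize * (2 / 2 ^ S.free i) ≤ S.maxSize * 2 := by
    gcongr
    exact div_le_self (by norm_num) (one_le_pow₀ (by norm_num))
  have h7 := mul_le_mul_of_nonneg_left h6 (by positivity : (0 : ℝ) ≤ b + 1)
  linarith

lemma machineLoad_le_makespan {n m : ℕ} (p : Fin n → ℝ) (σ : Fin n → Fin m) (i : Fin m) :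
    machineLoad p σ i ≤ makespan p σ :=
  le_csSup (Set.finite_range _).bddAbove ⟨i, rfl⟩

lemma le_makespan {n m : ℕ} {p : Fin n → ℝ} (hp : ∀ j, 0 ≤ p j) (σ : Fin n → Fin m)
    (j : Fin n) : p j ≤ makespan p σ :=
  (Finset.single_le_sum (f := p) (fun j _ => hp j) (by simp)).trans
    (machineLoad_le_makespan p σ (σ j))

lemma sum_le_mul_makespan {n m : ℕ} (p : Fin n → ℝ) (σ : Fin n → Fin m) :
    ∑ j, p j ≤ m * makespan p σ := by
  rw [← Finset.sum_fiberwise univ σ p]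
  have := Finset.sum_le_card_nsmul univ (machineLoad p σ) _ fun i _ =>
    machineLoad_le_makespan p σ i
  rwa [Finset.card_univ, Fintype.card_fin, nsmul_eq_mul] at this

/-- The jobs among the first `t` ones that are assigned to machine `i`. -/
def jobsBefore {n m : ℕ} (σ : Fin n → Fin m) (t : ℕ) (i : Fin m) : Finset (Fin n) :=
  univ.filter fun j => j.1 < t ∧ σ j = i

@[simp]
lemma jobsBefore_zero {n m : ℕ} (σ : Fin n → Fin m) (i : Fin m) : jobsBefore σ 0 i = ∅ := by
  simp [jobsBefore]

lemma jobsBefore_eq_filter {n m : ℕ} (σ : Fin n → Fin m) (i : Fin m) :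
    jobsBefore σ n i = univ.filter fun j => σ j = i := by
  simp [jobsBefore]

lemma notMem_jobsBefore {n m t : ℕ} (σ : Fin n → Fin m) (ht : t < n) (i : Fin m) :
    (⟨t, ht⟩ : Fin n) ∉ jobsBefore σ t i := by
  simp [jobsBefore]

lemma jobsBefore_succ {n m t : ℕ} (σ : Fin n → Fin m) (ht : t < n) (i : Fin m) :
    jobsBefore σ (t + 1) i
      = if σ ⟨t, ht⟩ = i then insert ⟨t, ht⟩ (jobsBefore σ t i) else jobsBefore σ t i := by
  ext j
  have hjt : (j : ℕ) < t + 1 ↔ j = ⟨t, ht⟩ ∨ (j : ℕ) < t := by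
    rw [Fin.ext_iff]
    change (j : ℕ) < t + 1 ↔ (j : ℕ) = t ∨ (j : ℕ) < t
    omega
  split_ifs with h <;>
    simp only [jobsBefore, Finset.mem_filter, Finset.mem_univ, true_and, Finset.mem_insert, hjt]
  · constructor
    · tauto
    · rintro (rfl | h1)
      · exact ⟨Or.inl rfl, h⟩
      · tauto
  · constructor
    · rintro ⟨rfl | h1, h2⟩
      · exact absurd h2 h
      · exact ⟨h1, h2⟩
    · tauto

lemma sum_card_jobsBefore_lt {n m t : ℕ} (σ : Fin n → Fin m) (ht : t < n) :
    ∑ i, (jobsBefore σ t i).card < n := by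
  have h1 := Finset.card_eq_sum_card_fiberwise (s := univ.filter fun j : Fin n => j.1 < t)
    (f := σ) (t := univ) (by simp)
  simp_rw [Finset.filter_filter] at h1
  unfold jobsBefore
  rw [← h1]
  exact (Finset.card_lt_univ_of_notMem (x := ⟨t, ht⟩) (by simp)).trans_eq (by simp)

/-- The online algorithm: put the latest job where the last step of the process puts it. -/
noncomputable def blockAlgorithm (m k b : ℕ) [NeZero m] (l : List ℝ) : Fin m :=
  (l.foldl (step b) (initial k)).last

/-- The state of the algorithm after the first `t` jobs. -/
noncomputable def stateAfter {n : ℕ} (m k b : ℕ) [NeZero m] (p : Fin n → ℝ) (t : ℕ) :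
    SchedState m :=
  ((List.ofFn p).take t).foldl (step b) (initial k)

section Run

variable {n m k b : ℕ} [NeZero m] (p : Fin n → ℝ)

lemma stateAfter_succ (j : Fin n) :
    stateAfter m k b p (j + 1) = (stateAfter m k b p j).step b (p j) := by
  have h : (j : ℕ) < (List.ofFn p).length := by simp
  rw [stateAfter, ← List.take_concat_get' _ _ h, List.foldl_append]
  simp [stateAfter]

lemma last_stateAfter_succ (j : Fin n) :
    (stateAfter m k b p (j + 1)).last = onlineSchedule (blockAlgorithm m k b) p j := rfl

variable {p}

lemma stateAfter_load {t : ℕ} (ht : t ≤ n) (i : Fin m) :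
    (stateAfter m k b p t).load i
      = ∑ j ∈ jobsBefore (onlineSchedule (blockAlgorithm m k b) p) t i, p j := by
  induction t with
  | zero => simp [stateAfter, initial]
  | succ t ih =>
    have hs := stateAfter_succ (m := m) (k := k) (b := b) p ⟨t, ht⟩
    have hl := last_stateAfter_succ (m := m) (k := k) (b := b) p ⟨t, ht⟩
    simp only at hs hl
    rw [hs] at hl ⊢
    rw [load_step, hl, ih (by omega), jobsBefore_succ _ ht]
    split_ifs with h
    · rw [Finset.sum_insert (notMem_jobsBefore _ ht i), add_comm]
    · rw [add_zero]

lemma stateAfter_maxSize_le {X : ℝ} (hX : 0 ≤ X) (hp : ∀ j, p j ≤ X) {t : ℕ} (ht : t ≤ n) :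
    (stateAfter m k b p t).maxSize ≤ X := by
  induction t with
  | zero => simpa [stateAfter, initial] using hX
  | succ t ih =>
    have hs := stateAfter_succ (m := m) (k := k) (b := b) p ⟨t, ht⟩
    simp only at hs
    rw [hs, maxSize_step]
    exact max_le (ih (by omega)) (hp _)

lemma stateAfter_spec (hb : 7 * b < m) (hn : n ≤ m * k) (hp : ∀ j, 0 ≤ p j) {t : ℕ}
    (ht : t ≤ n) :
    Invariant b (stateAfter m k b p t) ∧ ∀ i, (stateAfter m k b p t).free i
      + (jobsBefore (onlineSchedule (blockAlgorithm m k b) p) t i).card = k := by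
  induction t with
  | zero => exact ⟨by simpa [stateAfter] using invariant_initial b k, by simp [stateAfter, initial]⟩
  | succ t ih =>
    obtain ⟨hinv, hfree⟩ := ih (by omega)
    have hs := stateAfter_succ (m := m) (k := k) (b := b) p ⟨t, ht⟩
    have hl := last_stateAfter_succ (m := m) (k := k) (b := b) p ⟨t, ht⟩
    simp only at hs hl
    rw [hs] at hl ⊢
    set σ := onlineSchedule (blockAlgorithm m k b) p
    have hex : ∃ i, 0 < (stateAfter m k b p t).free i := by
      by_contra! h0
      have h1 : ∑ i, (jobsBefore σ t i).card = m * k := by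
        rw [Finset.sum_congr rfl fun i _ => by
          rw [← zero_add (jobsBefore σ t i).card, ← Nat.le_zero.1 (h0 i), hfree i]]
        simp
      have h2 := sum_card_jobsBefore_lt σ ht
      omega
    obtain ⟨hinv', hpos⟩ := step_spec hb hinv (hp ⟨t, ht⟩) hex
    refine ⟨hinv', fun i => ?_⟩
    rw [free_step, jobsBefore_succ σ ht]
    rw [hl] at hpos ⊢
    have hi := hfree i
    by_cases h : σ ⟨t, ht⟩ = i
    · rw [if_pos h, if_pos h.symm, Finset.card_insert_of_notMem (notMem_jobsBefore σ ht i)]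
      rw [h] at hpos
      omega
    · rwa [if_neg h, if_neg (Ne.symm h)]

end Run

lemma competitive_blockAlgorithm {m k b : ℕ} [NeZero m] (hb : 7 * b < m) (hb' : m ≤ 7 * (b + 1)) :
    Competitive m k (blockAlgorithm m k b) 20 := by
  intro n hn p hp
  obtain ⟨hinv, hfree⟩ := stateAfter_spec hb hn hp le_rfl
  have hfeas : Feasible k (onlineSchedule (blockAlgorithm m k b) p) := fun i => by
    have := hfree i
    rw [jobsBefore_eq_filter] at this
    omega
  refine ⟨hfeas, ?_⟩
  have key : ∀ τ : Fin n → Fin m,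
      makespan p (onlineSchedule (blockAlgorithm m k b) p) ≤ 20 * makespan p τ := by
    intro τ
    have hload : ∀ i, (stateAfter m k b p n).load i
        = machineLoad p (onlineSchedule (blockAlgorithm m k b) p) i := fun i => by
      rw [stateAfter_load le_rfl, machineLoad, jobsBefore_eq_filter]
    have hX : 0 ≤ makespan p τ :=
      (Finset.sum_nonneg fun j _ => hp j).trans (machineLoad_le_makespan p τ 0)
    refine csSup_le (Set.range_nonempty _) ?_
    rintro _ ⟨i, rfl⟩
    have h1 := hinv.load_le_maxSize_add_sum i
    have h2 : (stateAfter m k b p n).maxSize ≤ makespan p τ :=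
      stateAfter_maxSize_le hX (le_makespan hp τ) le_rfl
    have h3 : ∑ i, (stateAfter m k b p n).load i = ∑ j, p j := by
      simp_rw [hload, machineLoad]
      exact Finset.sum_fiberwise univ _ p
    have h4 := sum_le_mul_makespan p τ
    have h5 : (m : ℝ) * makespan p τ ≤ 7 * (b + 1) * makespan p τ :=
      mul_le_mul_of_nonneg_right (by exact_mod_cast hb') hX
    have hpos : (0 : ℝ) < b + 1 := by positivity
    have h6 := mul_le_mul_of_nonneg_left h2 hpos.le
    rw [h3, hload] at h1
    refine le_of_mul_le_mul_left ?_ hpos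
    linarith
  have h20 : makespan p (onlineSchedule (blockAlgorithm m k b) p) / 20 ≤ OPT m k p := by
    refine le_csInf ⟨_, _, hfeas, rfl⟩ ?_
    rintro _ ⟨τ, -, rfl⟩
    have := key τ
    simp only
    linarith
  linarith

/-- For all positive integers `m` and `k` there is a deterministic online algorithm for
cardinality constrained scheduling on `m` machines with cardinality bound `k` that is
`120`-competitive. -/
theorem exists_120_competitive_online_algorithm (m k : ℕ) (hm : 0 < m) (hk : 0 < k) :
    ∃ A : List ℝ → Fin m, Competitive m k A 120 := by
  have : NeZero m := ⟨hm.ne'⟩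
  refine ⟨blockAlgorithm m k ((m - 1) / 7), fun n hn p hp => ?_⟩
  obtain ⟨hfeas, hle⟩ := competitive_blockAlgorithm (m := m) (k := k) (b := (m - 1) / 7)
    (by omega) (by omega) n hn p hp
  refine ⟨hfeas, hle.trans (mul_le_mul_of_nonneg_right (by norm_num) ?_)⟩
  refine Real.sInf_nonneg ?_
  rintro _ ⟨τ, -, rfl⟩
  exact (Finset.sum_nonneg fun j _ => hp j).trans (machineLoad_le_makespan p τ 0)
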